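/- arXiv:math/0401060 — 3 statements merged into one kernel-verified Lean document; each statement's English description precedes it below -/
import Mathlib

section
/- If (A₁,B₁) and (A₂,B₂) are pairs of nonempty compact convex subsets of ℝⁿ of constant relative width (i.e. A₁ − B₁ and A₂ − B₂ are closed Euclidean balls), then for every t ∈ [0,1] the pair (tA₁ + (1−t)A₂, tB₁ + (1−t)B₂) of Minkowski combinations is also a pair of constant relative width. -/
open Metric
open scoped Pointwise

/-- `(A, B)` is a pair of constant relative width: the Minkowski difference
`A - B = {a - b : a ∈ A, b ∈ B}` is a closed euclidean ball. -/
def IsCRWPair {n : ℕ} (A B : Set (EuclideanSpace ℝ (Fin n))) : Prop :=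
  ∃ (c : EuclideanSpace ℝ (Fin n)) (r : ℝ), 0 ≤ r ∧ A - B = closedBall c r

/-- Minkowski combinations of two pairs of constant relative width again form a
pair of constant relative width. -/
theorem crw_minkowski_combination {n : ℕ}
    (A₁ B₁ A₂ B₂ : Set (EuclideanSpace ℝ (Fin n)))
    (hA₁ : A₁.Nonempty) (hA₁c : IsCompact A₁) (hA₁conv : Convex ℝ A₁)
    (hB₁ : B₁.Nonempty) (hB₁c : IsCompact B₁) (hB₁conv : Convex ℝ B₁)
    (hA₂ : A₂.Nonempty) (hA₂c : IsCompact A₂) (hA₂conv : Convex ℝ A₂)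
    (hB₂ : B₂.Nonempty) (hB₂c : IsCompact B₂) (hB₂conv : Convex ℝ B₂)
    (h₁ : IsCRWPair A₁ B₁) (h₂ : IsCRWPair A₂ B₂)
    (t : ℝ) (ht : t ∈ Set.Icc (0 : ℝ) 1) :
    IsCRWPair (t • A₁ + (1 - t) • A₂) (t • B₁ + (1 - t) • B₂) := by
  obtain ⟨c₁, r₁, hr₁, e₁⟩ := h₁
  obtain ⟨c₂, r₂, hr₂, e₂⟩ := h₂
  have smul_sub_set (s : ℝ) (A B : Set (EuclideanSpace ℝ (Fin n))) :
      s • A - s • B = s • (A - B) :=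
    (Set.image_sub (DistribSMul.toAddMonoidHom (EuclideanSpace ℝ (Fin n)) s)).symm
  refine ⟨t • c₁ + (1 - t) • c₂, ‖t‖ * r₁ + ‖1 - t‖ * r₂, by positivity, ?_⟩
  rw [add_sub_add_comm, smul_sub_set, smul_sub_set, e₁, e₂, smul_closedBall _ _ hr₁,
    smul_closedBall _ _ hr₂, closedBall_add_closedBall (by positivity) (by positivity)]
end

section
/- For n ≥ 2, the space crw(ℝⁿ) of all pairs (A,B) of nonempty compact convex subsets of ℝⁿ of constant relative width, equipped with the subspace topology inherited from the product of two copies of the hyperspace of nonempty compact convex subsets of ℝⁿ with the Hausdorff metric, is a contractible and locally compact topological space. -/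
open Metric TopologicalSpace
open scoped Pointwise

section Hyperspace

variable {E : Type*} [NormedAddCommGroup E] [NormedSpace ℝ E]

/-- The Minkowski sum `s • K + t • L` of two nonempty compact sets. -/
def TopologicalSpace.NonemptyCompacts.linearCombination (s t : ℝ) (K L : NonemptyCompacts E) :
    NonemptyCompacts E :=
  (K ×ˢ L).map (fun p => s • p.1 + t • p.2) (by fun_prop)

theorem TopologicalSpace.NonemptyCompacts.mem_linearCombination {s t : ℝ}
    {K L : NonemptyCompacts E} {z : E} :
    z ∈ (K.linearCombination s t L : Set E) ↔ ∃ x ∈ K, ∃ y ∈ L, s • x + t • y = z := by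
  simp [linearCombination, and_assoc]

theorem TopologicalSpace.NonemptyCompacts.continuous_linearCombination (s t : ℝ) :
    Continuous fun p : NonemptyCompacts E × NonemptyCompacts E =>
      p.1.linearCombination s t p.2 :=
  (Continuous.nonemptyCompacts_map (by fun_prop)).comp continuous_prod

theorem TopologicalSpace.NonemptyCompacts.isClosed_setOf_convex :
    IsClosed {K : NonemptyCompacts E | Convex ℝ (K : Set E)} := by
  have h : {K : NonemptyCompacts E | Convex ℝ (K : Set E)} =
      ⋂ (a : ℝ) (b : ℝ) (_ : 0 ≤ a) (_ : 0 ≤ b) (_ : a + b = 1),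
        {K | K.linearCombination a b K = K} := by
    ext K
    simp only [Set.mem_ofPred_eq, Set.mem_iInter]
    refine ⟨fun hK a b ha hb hab => NonemptyCompacts.ext (Set.ext fun z => ?_),
      fun hK x hx y hy a b ha hb hab => ?_⟩
    · rw [mem_linearCombination]
      refine ⟨?_, fun hz => ⟨z, hz, z, hz, by rw [← add_smul, hab, one_smul]⟩⟩
      rintro ⟨x, hx, y, hy, rfl⟩
      exact hK hx hy ha hb hab
    · rw [← hK a b ha hb hab, mem_linearCombination]
      exact ⟨x, hx, y, hy, rfl⟩
  rw [h]
  refine isClosed_iInter fun a => isClosed_iInter fun b => isClosed_iInter fun _ =>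
    isClosed_iInter fun _ => isClosed_iInter fun _ => isClosed_eq ?_ continuous_id
  exact (continuous_linearCombination a b).comp (continuous_id.prodMk continuous_id)

/-- The dilation `t • K` of a nonempty compact set. -/
def TopologicalSpace.NonemptyCompacts.dilate (t : ℝ) (K : NonemptyCompacts E) :
    NonemptyCompacts E :=
  (({t} : NonemptyCompacts ℝ) ×ˢ K).map (fun p => p.1 • p.2) (by fun_prop)

theorem TopologicalSpace.NonemptyCompacts.coe_dilate (t : ℝ) (K : NonemptyCompacts E) :
    (K.dilate t : Set E) = t • (K : Set E) := by
  ext z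
  simp [dilate, Set.mem_smul_set]

theorem TopologicalSpace.NonemptyCompacts.continuous_dilate :
    Continuous fun p : ℝ × NonemptyCompacts E => p.2.dilate p.1 :=
  (Continuous.nonemptyCompacts_map (by fun_prop)).comp
    (continuous_prod.comp ((continuous_singleton.comp continuous_fst).prodMk continuous_snd))

theorem TopologicalSpace.NonemptyCompacts.dilate_zero (K : NonemptyCompacts E) :
    K.dilate 0 = {0} := by
  refine NonemptyCompacts.ext ?_
  rw [coe_dilate, Set.zero_smul_set K.nonempty]
  ext; simp

theorem TopologicalSpace.NonemptyCompacts.dilate_one (K : NonemptyCompacts E) :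
    K.dilate 1 = K := by
  refine NonemptyCompacts.ext ?_
  rw [coe_dilate, one_smul]

theorem TopologicalSpace.NonemptyCompacts.isClosed_setOf_eq_closedBall [ProperSpace E]
    [Nontrivial E] :
    IsClosed {K : NonemptyCompacts E | ∃ (c : E) (r : ℝ), 0 ≤ r ∧ (K : Set E) = closedBall c r} := by
  let B : NonemptyCompacts E :=
    ⟨⟨closedBall 0 1, isCompact_closedBall 0 1⟩, ⟨0, by simp⟩⟩
  let ball : E × ℝ → NonemptyCompacts E := fun p =>
    ({p.1} : NonemptyCompacts E).linearCombination 1 1 (B.dilate p.2)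
  have hball : Continuous ball := (continuous_linearCombination 1 1).comp
    ((continuous_singleton.comp continuous_fst).prodMk
      (continuous_dilate.comp (continuous_snd.prodMk continuous_const)))
  have ball_coe (c : E) (r : ℝ) (hr : 0 ≤ r) : (ball (c, r) : Set E) = closedBall c r := by
    have hB : (B.dilate r : Set E) = closedBall 0 r := by
      rw [coe_dilate]
      change r • closedBall (0 : E) 1 = _
      rw [_root_.smul_closedBall _ _ zero_le_one]
      simp [abs_of_nonneg hr]
    ext z
    rw [mem_linearCombination]
    constructor
    · rintro ⟨x, hx, y, hy, rfl⟩
      rw [← SetLike.mem_coe, hB] at hy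
      rw [NonemptyCompacts.mem_singleton] at hx
      simpa [hx] using hy
    · intro hz
      refine ⟨c, by simp, z - c, ?_, by simp⟩
      rw [← SetLike.mem_coe, hB]
      simpa [dist_eq_norm] using hz
  refine IsSeqClosed.isClosed fun u K hu hK => ?_
  obtain ⟨R, hR⟩ := K.isCompact.isBounded.subset_ball 0
  have hopen : IsOpen {L : NonemptyCompacts E | (L : Set E) ⊆ Metric.ball 0 R} :=
    isOpen_subsets_of_isOpen isOpen_ball
  have hcomp : IsCompact (ball '' (closedBall 0 R ×ˢ Set.Icc 0 (2 * R))) :=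
    ((isCompact_closedBall 0 R).prod isCompact_Icc).image hball
  have hmem : K ∈ ball '' (closedBall 0 R ×ˢ Set.Icc 0 (2 * R)) := by
    refine hcomp.isClosed.mem_of_tendsto hK ?_
    filter_upwards [hK.eventually (hopen.mem_nhds hR)] with k hk
    obtain ⟨c, r, hr, hkr⟩ := hu k
    have hsub : closedBall c r ⊆ Metric.ball 0 R := hkr ▸ hk
    have hc : ‖c‖ < R := by simpa using hsub (mem_closedBall_self hr)
    obtain ⟨e, he⟩ := exists_norm_eq E hr
    have hce : ‖c + e‖ < R := by simpa using hsub (show c + e ∈ closedBall c r by simp [he])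
    refine ⟨(c, r), ⟨by simpa using hc.le, hr, ?_⟩,
      NonemptyCompacts.ext ((ball_coe c r hr).trans hkr.symm)⟩
    have := norm_sub_le (c + e) c
    rw [add_sub_cancel_left, he] at this
    linarith
  obtain ⟨⟨c, r⟩, ⟨-, hr, -⟩, rfl⟩ := hmem
  exact ⟨c, r, hr, ball_coe c r hr⟩

end Hyperspace

theorem IsCRWPair.smul {n : ℕ} {A B : Set (EuclideanSpace ℝ (Fin n))} (h : IsCRWPair A B)
    (t : ℝ) : IsCRWPair (t • A) (t • B) := by
  obtain ⟨c, r, hr, h⟩ := h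
  refine ⟨t • c, ‖t‖ * r, by positivity, ?_⟩
  rw [← _root_.smul_closedBall _ _ hr, ← h, ← Set.image_smul, ← Set.image_smul, ← Set.image_smul,
    ← Set.image2_sub, ← Set.image2_sub, Set.image2_image_left, Set.image2_image_right,
    Set.image_image2]
  simp only [smul_sub]

theorem isClosed_setOf_isCRWPair {n : ℕ} (hn : 1 ≤ n) :
    IsClosed {P : NonemptyCompacts (EuclideanSpace ℝ (Fin n)) ×
      NonemptyCompacts (EuclideanSpace ℝ (Fin n)) |
        IsCRWPair (P.1 : Set (EuclideanSpace ℝ (Fin n))) P.2} := by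
  have : Nonempty (Fin n) := ⟨⟨0, hn⟩⟩
  convert NonemptyCompacts.isClosed_setOf_eq_closedBall.preimage
    (NonemptyCompacts.continuous_linearCombination (E := EuclideanSpace ℝ (Fin n)) 1 (-1)) using 1
  ext P
  have h : (P.1.linearCombination 1 (-1) P.2 : Set (EuclideanSpace ℝ (Fin n))) =
      (P.1 : Set (EuclideanSpace ℝ (Fin n))) - P.2 := by
    ext z
    rw [NonemptyCompacts.mem_linearCombination]
    simp only [Set.mem_sub, SetLike.mem_coe, one_smul, neg_one_smul, ← sub_eq_add_neg]
  simp only [Set.mem_ofPred_eq, Set.mem_preimage, IsCRWPair, h]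

/-- For `n ≥ 2`, the space `crw(ℝⁿ)` of pairs of nonempty compact convex subsets
of `ℝⁿ` of constant relative width, topologized as a subspace of the square of
the hyperspace with its Hausdorff metric, is contractible and locally compact. -/
theorem crw_contractible_locallyCompact (n : ℕ) (hn : 2 ≤ n) :
    ContractibleSpace {P : NonemptyCompacts (EuclideanSpace ℝ (Fin n)) ×
        NonemptyCompacts (EuclideanSpace ℝ (Fin n)) //
        Convex ℝ (P.1 : Set (EuclideanSpace ℝ (Fin n))) ∧
        Convex ℝ (P.2 : Set (EuclideanSpace ℝ (Fin n))) ∧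
        IsCRWPair (P.1 : Set (EuclideanSpace ℝ (Fin n)))
          (P.2 : Set (EuclideanSpace ℝ (Fin n)))} ∧
    LocallyCompactSpace {P : NonemptyCompacts (EuclideanSpace ℝ (Fin n)) ×
        NonemptyCompacts (EuclideanSpace ℝ (Fin n)) //
        Convex ℝ (P.1 : Set (EuclideanSpace ℝ (Fin n))) ∧
        Convex ℝ (P.2 : Set (EuclideanSpace ℝ (Fin n))) ∧
        IsCRWPair (P.1 : Set (EuclideanSpace ℝ (Fin n)))
          (P.2 : Set (EuclideanSpace ℝ (Fin n)))} := by
  constructor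
  · rw [contractible_iff_id_nullhomotopic]
    refine ⟨⟨({0}, {0}), ?_, ?_, 0, 0, le_rfl, ?_⟩, ContinuousMap.Homotopic.symm ⟨⟨⟨fun p =>
      ⟨(p.2.1.1.dilate p.1, p.2.1.2.dilate p.1), ?_, ?_, ?_⟩, ?_⟩, fun P => ?_, fun P => ?_⟩⟩⟩
    · exact convex_singleton 0
    · exact convex_singleton 0
    · change ({0} : Set (EuclideanSpace ℝ (Fin n))) - {0} = _
      simp
    · rw [NonemptyCompacts.coe_dilate]
      exact p.2.2.1.smul _
    · rw [NonemptyCompacts.coe_dilate]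
      exact p.2.2.2.1.smul _
    · rw [NonemptyCompacts.coe_dilate, NonemptyCompacts.coe_dilate]
      exact p.2.2.2.2.smul _
    · refine Continuous.subtype_mk (Continuous.prodMk ?_ ?_) _
      · exact NonemptyCompacts.continuous_dilate.comp
          ((continuous_subtype_val.comp continuous_fst).prodMk
            (continuous_fst.comp (continuous_subtype_val.comp continuous_snd)))
      · exact NonemptyCompacts.continuous_dilate.comp
          ((continuous_subtype_val.comp continuous_fst).prodMk
            (continuous_snd.comp (continuous_subtype_val.comp continuous_snd)))
    · exact Subtype.ext (Prod.ext (NonemptyCompacts.dilate_zero _)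
        (NonemptyCompacts.dilate_zero _))
    · exact Subtype.ext (Prod.ext (NonemptyCompacts.dilate_one _)
        (NonemptyCompacts.dilate_one _))
  · refine IsClosed.locallyCompactSpace ?_
    exact (NonemptyCompacts.isClosed_setOf_convex.preimage continuous_fst).inter
      ((NonemptyCompacts.isClosed_setOf_convex.preimage continuous_snd).inter
        (isClosed_setOf_isCRWPair (by lia)))
end

section
/- In the Minkowski space (ℝⁿ, ‖·‖_∞), a compact convex body K (nonempty compact convex set with nonempty interior) has constant width, i.e. K − K = {a − b : a,b ∈ K} is a closed ‖·‖_∞-ball centered at the origin, if and only if K is itself a closed ‖·‖_∞-ball, i.e. K = {x : ‖x − c‖_∞ ≤ r} for some c ∈ ℝⁿ and r > 0. -/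
open Metric
open scoped Pointwise

/-- A convex set containing all the vertices of a box contains the box. -/
theorem Icc_subset_of_vertices_subset {ι : Type*} [Finite ι] {K : Set (ι → ℝ)}
    (hK : Convex ℝ K) {a b : ι → ℝ} (hab : a ≤ b)
    (hv : ∀ v : ι → ℝ, (∀ i, v i = a i ∨ v i = b i) → v ∈ K) : Set.Icc a b ⊆ K := by
  have h : convexHull ℝ (Set.univ.pi fun i => ({a i, b i} : Set ℝ)) ⊆ K :=
    convexHull_min (fun v hvi => hv v fun i => hvi i trivial) hK
  rw [convexHull_pi] at h
  refine fun x hx => h fun i _ => ?_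
  beta_reduce
  rw [convexHull_pair, segment_eq_Icc (hab i)]
  exact ⟨hx.1 i, hx.2 i⟩

/-- A convex set in a finite power of `ℝ` whose difference body is a sup-norm ball of radius
`r ≥ 0` centered at the origin is a cube of side length `r`. -/
theorem exists_eq_Icc_of_sub_eq_closedBall {ι : Type*} [Fintype ι] {K : Set (ι → ℝ)}
    (hK : Convex ℝ K) {r : ℝ} (hr : 0 ≤ r) (h : K - K = closedBall 0 r) :
    ∃ a : ι → ℝ, K = Set.Icc a (fun i => a i + r) := by
  have hdiff : ∀ x ∈ K, ∀ y ∈ K, ∀ i, x i - y i ≤ r := fun x hx y hy i => by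
    have hxy : x - y ∈ closedBall (0 : ι → ℝ) r := h ▸ Set.sub_mem_sub hx hy
    rw [mem_closedBall_zero_iff, pi_norm_le_iff_of_nonneg hr] at hxy
    exact (le_abs_self _).trans (hxy i)
  have hrealize : ∀ d : ι → ℝ, (∀ i, |d i| ≤ r) → ∃ x ∈ K, ∃ y ∈ K, ∀ i, x i - y i = d i :=
    fun d hd => by
      have hmem : d ∈ K - K := by
        rw [h, mem_closedBall_zero_iff, pi_norm_le_iff_of_nonneg hr]
        exact hd
      obtain ⟨x, hx, y, hy, rfl⟩ := hmem
      exact ⟨x, hx, y, hy, fun _ => rfl⟩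
  obtain ⟨b, hb, a, ha, hba⟩ := hrealize (fun _ => r) fun _ => (abs_of_nonneg hr).le
  refine ⟨a, Set.Subset.antisymm (fun x hx => ⟨fun i => ?_, fun i => ?_⟩) ?_⟩
  · linarith [hdiff b hb x hx i, hba i]
  · linarith [hdiff x hx a ha i]
  · refine Icc_subset_of_vertices_subset hK (fun i => le_add_of_nonneg_right hr) fun v hv => ?_
    obtain ⟨x, hx, y, hy, hxy⟩ := hrealize (fun i => 2 * (v i - a i) - r) fun i => by
      rcases hv i with hi | hi <;> rw [hi, abs_le] <;> constructor <;> linarith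
    have hvx : v = x := by
      ext i
      have h₁ := hdiff b hb x hx i
      have h₂ := hdiff b hb y hy i
      have h₃ := hdiff x hx a ha i
      have h₄ := hdiff y hy a ha i
      have h₅ := hba i
      have h₆ := hxy i
      rcases hv i with hi | hi <;> linarith
    exact hvx ▸ hx

theorem Icc_add_const_eq_closedBall {ι : Type*} [Fintype ι] (a : ι → ℝ) {r : ℝ} (hr : 0 ≤ r) :
    Set.Icc a (fun i => a i + r) = closedBall (fun i => a i + r / 2) (r / 2) := by
  rw [closedBall_pi _ (by positivity), ← Set.pi_univ_Icc]
  refine Set.pi_congr rfl fun i _ => ?_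
  rw [Real.closedBall_eq_Icc]
  congr 1 <;> ring

/-- In the Minkowski space `(ℝⁿ, ‖·‖_∞)` (here `Fin n → ℝ` with its sup norm),
a compact convex body `K` has constant width (i.e. `K - K` is a closed
`‖·‖_∞`-ball centered at the origin) if and only if `K` is itself a closed
`‖·‖_∞`-ball of positive radius. -/
theorem linf_constWidth_iff_ball {n : ℕ} (K : Set (Fin n → ℝ))
    (hK : K.Nonempty) (hKc : IsCompact K) (hKconv : Convex ℝ K)
    (hKint : (interior K).Nonempty) :
    (∃ r : ℝ, K - K = closedBall (0 : Fin n → ℝ) r) ↔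
      ∃ (c : Fin n → ℝ) (r : ℝ), 0 < r ∧ K = closedBall c r := by
  constructor
  · rintro ⟨r, h⟩
    have hr : 0 ≤ r := nonempty_closedBall.1 (h ▸ hK.sub hK)
    obtain ⟨a, ha⟩ := exists_eq_Icc_of_sub_eq_closedBall hKconv hr h
    rw [Icc_add_const_eq_closedBall a hr] at ha
    rcases hr.eq_or_lt with rfl | hr
    · rcases isEmpty_or_nonempty (Fin n) with _ | _
      · exact ⟨0, 1, one_pos, Subsingleton.eq_univ_of_nonempty hK |>.trans
          (Subsingleton.eq_univ_of_nonempty (nonempty_closedBall.2 zero_le_one)).symm⟩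
      · rw [ha, zero_div, closedBall_zero, interior_singleton] at hKint
        exact (Set.not_nonempty_empty hKint).elim
    · exact ⟨_, r / 2, half_pos hr, ha⟩
  · rintro ⟨c, r, hr, rfl⟩
    exact ⟨r + r, by rw [closedBall_sub_closedBall hr.le hr.le, sub_self]⟩
end
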